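/- arXiv:2301.05758 — 2 statements merged into one kernel-verified Lean document; each statement's English description precedes it below -/
import Mathlib

section
/- Let P be the Pell sequence (P_0 = 0, P_1 = 1, P_n = 2P_{n-1} + P_{n-2}), Q the associated Pell sequence (Q_0 = 1, Q_1 = 1, Q_n = 2Q_{n-1} + Q_{n-2}), and c the Lucas-cobalancing sequence (c_0 = −1, c_1 = 1, c_n = 6c_{n-1} − c_{n-2}). Define σ_c(k,n) = Σ_{i=1}^{k} c_{n+i}. For all k ≥ 1 and all n ≥ 0: 2·σ_c(k,n) = Q_{2k+2n} − Q_{2n}; moreover if k is even then σ_c(k,n) = 2·P_k·P_{k+2n}, and if k is odd then σ_c(k,n) = Q_k·Q_{k+2n}. -/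
/-- The Pell sequence: P₀ = 0, P₁ = 1, Pₙ = 2Pₙ₋₁ + Pₙ₋₂. -/
def pell : ℕ → ℤ
  | 0 => 0
  | 1 => 1
  | n + 2 => 2 * pell (n + 1) + pell n

/-- The associated Pell sequence: Q₀ = 1, Q₁ = 1, Qₙ = 2Qₙ₋₁ + Qₙ₋₂. -/
def assocPell : ℕ → ℤ
  | 0 => 1
  | 1 => 1
  | n + 2 => 2 * assocPell (n + 1) + assocPell n

/-- The Lucas-cobalancing sequence: c₀ = −1, c₁ = 1, cₙ = 6cₙ₋₁ − cₙ₋₂. -/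
def lucasCobalancing : ℕ → ℤ
  | 0 => -1
  | 1 => 1
  | n + 2 => 6 * lucasCobalancing (n + 1) - lucasCobalancing n

theorem pell_assocPell_succ (n : ℕ) :
    pell (n + 1) = pell n + assocPell n ∧ assocPell (n + 1) = assocPell n + 2 * pell n := by
  induction n with
  | zero => simp [pell, assocPell]
  | succ n ih =>
    obtain ⟨hp, hq⟩ := ih
    constructor
    · rw [pell]; linarith
    · rw [assocPell]; linarith

theorem pell_assocPell_add (m n : ℕ) :
    pell (m + n) = pell m * assocPell n + assocPell m * pell n ∧
      assocPell (m + n) = assocPell m * assocPell n + 2 * pell m * pell n := by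
  induction n with
  | zero => simp [pell, assocPell]
  | succ n ih =>
    obtain ⟨hp, hq⟩ := ih
    rw [← add_assoc, (pell_assocPell_succ (m + n)).1, (pell_assocPell_succ (m + n)).2,
      (pell_assocPell_succ n).1, (pell_assocPell_succ n).2, hp, hq]
    constructor <;> ring

theorem assocPell_sq_sub_two_mul_pell_sq (n : ℕ) :
    assocPell n ^ 2 - 2 * pell n ^ 2 = (-1) ^ n := by
  induction n with
  | zero => simp [pell, assocPell]
  | succ n ih =>
    rw [(pell_assocPell_succ n).1, (pell_assocPell_succ n).2, pow_succ (-1), ← ih]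
    ring

theorem assocPell_mul_assocPell_sub (k m : ℕ) :
    assocPell k * assocPell (k + m) - 2 * pell k * pell (k + m) = (-1) ^ k * assocPell m := by
  rw [(pell_assocPell_add k m).1, (pell_assocPell_add k m).2,
    ← assocPell_sq_sub_two_mul_pell_sq k]
  ring

theorem two_mul_lucasCobalancing_succ (n : ℕ) :
    2 * lucasCobalancing (n + 1) = assocPell (2 * n + 2) - assocPell (2 * n) := by
  induction n using Nat.twoStepInduction with
  | zero => simp [lucasCobalancing, assocPell]
  | one => simp [lucasCobalancing, assocPell]
  | more n ih₀ ih₁ =>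
    rw [lucasCobalancing]
    simp only [mul_add, Nat.reduceMul, add_assoc, Nat.reduceAdd, assocPell] at ih₀ ih₁ ⊢
    linarith

theorem two_mul_sum_lucasCobalancing (k n : ℕ) :
    2 * (∑ i ∈ Finset.Icc 1 k, lucasCobalancing (n + i)) =
      assocPell (2 * k + 2 * n) - assocPell (2 * n) := by
  induction k with
  | zero => simp
  | succ k ih =>
    have h := two_mul_lucasCobalancing_succ (n + k)
    rw [show 2 * (n + k) = 2 * k + 2 * n by ring] at h
    rw [Finset.sum_Icc_succ_top (by omega), mul_add, ih, ← add_assoc, h,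
      show 2 * (k + 1) + 2 * n = 2 * k + 2 * n + 2 by ring]
    ring

theorem sigma_lucasCobalancing (k n : ℕ) (hk : 1 ≤ k) :
    2 * (∑ i ∈ Finset.Icc 1 k, lucasCobalancing (n + i)) =
      assocPell (2 * k + 2 * n) - assocPell (2 * n) ∧
    (Even k →
      ∑ i ∈ Finset.Icc 1 k, lucasCobalancing (n + i) = 2 * pell k * pell (k + 2 * n)) ∧
    (Odd k →
      ∑ i ∈ Finset.Icc 1 k, lucasCobalancing (n + i) = assocPell k * assocPell (k + 2 * n)) := by
  have hsum := two_mul_sum_lucasCobalancing k n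
  have hadd := (pell_assocPell_add k (k + 2 * n)).2
  have hsub := assocPell_mul_assocPell_sub k (2 * n)
  rw [show k + (k + 2 * n) = 2 * k + 2 * n by ring] at hadd
  refine ⟨hsum, fun h => ?_, fun h => ?_⟩
  · rw [h.neg_one_pow] at hsub
    linarith
  · rw [h.neg_one_pow] at hsub
    linarith
end

section
/- Let P be the Pell sequence (P_0 = 0, P_1 = 1, P_n = 2P_{n-1} + P_{n-2}). For all k ≥ 1, the 2-adic valuation of P_k equals the 2-adic valuation of k, i.e., ν_2(P_k) = ν_2(k). -/
theorem pell_add_two (n : ℕ) : pell (n + 2) = 2 * pell (n + 1) + pell n := rfl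

theorem pell_succ_pos_and_nonneg (n : ℕ) : 0 < pell (n + 1) ∧ 0 ≤ pell n := by
  induction n with
  | zero => simp [pell]
  | succ n ih => rw [pell_add_two]; omega

theorem pell_pos {n : ℕ} (hn : 1 ≤ n) : 0 < pell n := by
  obtain ⟨m, rfl⟩ := Nat.exists_eq_add_of_le' hn
  exact (pell_succ_pos_and_nonneg m).1

theorem pell_emod_two (n : ℕ) : pell n % 2 = n % 2 ∧ pell (n + 1) % 2 = (n + 1) % 2 := by
  induction n with
  | zero => simp [pell]
  | succ n ih =>
    rw [pell_add_two]
    push_cast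
    omega

theorem pell_add (m n : ℕ) :
    pell (m + n + 1) = pell (m + 1) * pell (n + 1) + pell m * pell n := by
  induction n generalizing m with
  | zero => simp [pell]
  | succ n ih =>
    rw [show m + (n + 1) + 1 = m + 1 + n + 1 by ring, ih, pell_add_two, pell_add_two]
    ring

theorem pell_two_mul (n : ℕ) : pell (2 * n) = 2 * (pell n * (pell (n + 1) - pell n)) := by
  cases n with
  | zero => simp [pell]
  | succ n =>
    rw [show 2 * (n + 1) = n + 1 + n + 1 by ring, pell_add, pell_add_two]
    ring

theorem pell_two_adic_valuation (k : ℕ) (hk : 1 ≤ k) :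
    padicValInt 2 (pell k) = padicValNat 2 k := by
  induction k using Nat.strong_induction_on with
  | _ k ih =>
    obtain ⟨n, rfl | rfl⟩ := Nat.even_or_odd' k
    · have hn : 1 ≤ n := by omega
      have hpos := pell_pos hn
      have hpar := pell_emod_two n
      have hodd : ¬ (2 : ℤ) ∣ pell (n + 1) - pell n := by omega
      have hne : pell (n + 1) - pell n ≠ 0 := fun h ↦ hodd (h ▸ dvd_zero 2)
      have hval : padicValInt 2 (pell (n + 1) - pell n) = 0 :=
        padicValInt.eq_zero_of_not_dvd (mod_cast hodd)
      have htwo : padicValInt 2 2 = 1 := padicValInt.self one_lt_two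
      rw [pell_two_mul, padicValInt.mul two_ne_zero (mul_ne_zero hpos.ne' hne),
        padicValInt.mul hpos.ne' hne, hval, htwo, ih n (by omega) hn,
        padicValNat.mul two_ne_zero (by omega), padicValNat.self one_lt_two, add_zero]
    · have hpar := (pell_emod_two (2 * n + 1)).1
      rw [padicValInt.eq_zero_of_not_dvd (by push_cast at *; omega),
        padicValNat.eq_zero_of_not_dvd (by omega)]
end
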